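/- arXiv:math/0401085 — 2 statements merged into one kernel-verified Lean document; each statement's English description precedes it below -/
import Mathlib

section
/- For every purely imaginary ν ∈ ℂ, every integer p, every sign δ ∈ {1,−1} and every u > 0, the improper integral lim_{T→∞} ∫_{−T}^{T} e^{−2πiδx} (u/(x²+u²))^{ν+1/2} ((x−iu)/(x+iu))^p dx exists (the limit converges in ℂ). -/
open MeasureTheory Filter Complex Real

/-- An oscillatory integral against a function that vanishes at infinity and has an integrable
derivative converges. -/
theorem exists_tendsto_intervalIntegral_exp_mul {c : ℂ} (hc : c ≠ 0) (hre : c.re = 0)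
    {F F' : ℝ → ℂ} (hF : ∀ x, HasDerivAt F (F' x) x) (hF' : Integrable F')
    (htop : Tendsto F atTop (nhds 0)) (hbot : Tendsto F atBot (nhds 0)) :
    ∃ L : ℂ, Tendsto (fun T : ℝ => ∫ x : ℝ in (-T)..T, Complex.exp (c * x) * F x)
      atTop (nhds L) := by
  have hE : ∀ x : ℝ, HasDerivAt (fun x : ℝ => Complex.exp (c * x) / c)
      (Complex.exp (c * x)) x := fun x => by
    have h := (((hasDerivAt_id (x : ℂ)).const_mul c).cexp.div_const c).comp_ofReal
    simpa [hc] using h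
  have hnorm : ∀ x : ℝ, ‖Complex.exp (c * x) / c‖ = ‖c‖⁻¹ := fun x => by
    rw [norm_div, Complex.norm_exp]
    simp [hre]
  have hcont : Continuous fun x : ℝ => Complex.exp (c * x) := by fun_prop
  have hint : Integrable fun x : ℝ => F' x * (Complex.exp (c * x) / c) :=
    hF'.mul_bdd (c := ‖c‖⁻¹) (hcont.div_const c).aestronglyMeasurable
      (Eventually.of_forall fun x => (hnorm x).le)
  have hparts : ∀ T : ℝ, ∫ x : ℝ in (-T)..T, Complex.exp (c * x) * F x =
      F T * (Complex.exp (c * T) / c) - F (-T) * (Complex.exp (c * (-T : ℝ)) / c) -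
        ∫ x : ℝ in (-T)..T, F' x * (Complex.exp (c * x) / c) := fun T => by
    rw [← intervalIntegral.integral_mul_deriv_eq_deriv_mul (fun x _ => hF x) (fun x _ => hE x)
      hF'.intervalIntegrable (hcont.intervalIntegrable _ _)]
    simp_rw [mul_comm]
  have hzero : ∀ {l : Filter ℝ}, Tendsto F l (nhds 0) →
      Tendsto (fun x => F x * (Complex.exp (c * x) / c)) l (nhds 0) := fun h => by
    have h' := h.norm.mul_const ‖c‖⁻¹
    rw [norm_zero, zero_mul] at h'
    refine tendsto_zero_iff_norm_tendsto_zero.2 (h'.congr fun x => ?_)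
    rw [norm_mul, hnorm]
  simp_rw [hparts]
  exact ⟨_, ((hzero htop).sub ((hzero hbot).comp tendsto_neg_atTop_atBot)).sub
    (intervalIntegral_tendsto_integral hint tendsto_neg_atTop_atBot tendsto_id)⟩

section Kernel

variable {u : ℝ}

theorem ofReal_add_I_mul_ne_zero (hu : u ≠ 0) (x : ℝ) : (x : ℂ) + Complex.I * u ≠ 0 := fun h => by
  have := congrArg Complex.im h
  simp [hu] at this

theorem ofReal_sub_I_mul_ne_zero (hu : u ≠ 0) (x : ℝ) : (x : ℂ) - Complex.I * u ≠ 0 := fun h => by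
  have := congrArg Complex.im h
  simp [hu] at this

theorem hasDerivAt_cpow_mul_zpow (hu : 0 < u) (s : ℂ) (p : ℤ) (x : ℝ) :
    HasDerivAt (fun x : ℝ => ((u / (x ^ 2 + u ^ 2) : ℝ) : ℂ) ^ s *
        (((x : ℂ) - Complex.I * u) / ((x : ℂ) + Complex.I * u)) ^ p)
      (((u / (x ^ 2 + u ^ 2) : ℝ) : ℂ) ^ s *
        (((x : ℂ) - Complex.I * u) / ((x : ℂ) + Complex.I * u)) ^ p *
        ((-2 * s * x + 2 * p * Complex.I * u) / ((x ^ 2 + u ^ 2 : ℝ) : ℂ))) x := by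
  have hp := ofReal_add_I_mul_ne_zero hu.ne' x
  have hm := ofReal_sub_I_mul_ne_zero hu.ne' x
  have hw := div_ne_zero hm hp
  have hq : x ^ 2 + u ^ 2 ≠ 0 := by positivity
  have hpos : 0 < u / (x ^ 2 + u ^ 2) := by positivity
  have hfac : ((x ^ 2 + u ^ 2 : ℝ) : ℂ) =
      ((x : ℂ) - Complex.I * u) * ((x : ℂ) + Complex.I * u) := by
    push_cast
    linear_combination (u : ℂ) ^ 2 * Complex.I_sq
  have hy : HasDerivAt (fun x : ℝ => u / (x ^ 2 + u ^ 2))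
      (u / (x ^ 2 + u ^ 2) * (-2 * x / (x ^ 2 + u ^ 2))) x := by
    have h := (hasDerivAt_const x u).div (((hasDerivAt_id x).pow 2).add_const (u ^ 2)) hq
    refine h.congr_deriv ?_
    simp
    field_simp
  have hys : HasDerivAt (fun x : ℝ => ((u / (x ^ 2 + u ^ 2) : ℝ) : ℂ) ^ s)
      (((u / (x ^ 2 + u ^ 2) : ℝ) : ℂ) ^ s * (s * ((-2 * x / (x ^ 2 + u ^ 2) : ℝ) : ℂ))) x := by
    have h := (hasStrictDerivAt_cpow_const (c := s)
      (Complex.ofReal_mem_slitPlane.2 hpos)).hasDerivAt.comp x hy.ofReal_comp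
    refine h.congr_deriv ?_
    have hne : ((u / (x ^ 2 + u ^ 2) : ℝ) : ℂ) ≠ 0 := Complex.ofReal_ne_zero.2 hpos.ne'
    rw [Complex.cpow_sub _ _ hne, Complex.cpow_one, Complex.ofReal_mul]
    field_simp
  have hwp : HasDerivAt
      (fun x : ℝ => (((x : ℂ) - Complex.I * u) / ((x : ℂ) + Complex.I * u)) ^ p)
      ((((x : ℂ) - Complex.I * u) / ((x : ℂ) + Complex.I * u)) ^ p *
        (2 * p * Complex.I * u / ((x ^ 2 + u ^ 2 : ℝ) : ℂ))) x := by
    have hx : HasDerivAt (fun x : ℝ => (x : ℂ)) 1 x := (hasDerivAt_id x).ofReal_comp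
    have hd : HasDerivAt
        (fun x : ℝ => ((x : ℂ) - Complex.I * u) / ((x : ℂ) + Complex.I * u)) _ x :=
      (hx.sub_const (Complex.I * u)).div (hx.add_const (Complex.I * u)) hp
    have h := HasDerivAt.comp (h₂ := fun z : ℂ => z ^ p) x (hasDerivAt_zpow p _ (Or.inl hw)) hd
    refine h.congr_deriv ?_
    rw [zpow_sub_one₀ hw, hfac]
    field_simp
    ring
  refine (hys.mul hwp).congr_deriv ?_
  push_cast
  ring

theorem norm_cpow_mul_zpow (hu : 0 < u) {s : ℂ} (hs : s.re = 1 / 2) (p : ℤ) (x : ℝ) :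
    ‖((u / (x ^ 2 + u ^ 2) : ℝ) : ℂ) ^ s *
        (((x : ℂ) - Complex.I * u) / ((x : ℂ) + Complex.I * u)) ^ p‖ =
      √(u / (x ^ 2 + u ^ 2)) := by
  have hpos : 0 < u / (x ^ 2 + u ^ 2) := by positivity
  have hconj : (x : ℂ) - Complex.I * u = (starRingEnd ℂ) ((x : ℂ) + Complex.I * u) := by
    simp [sub_eq_add_neg]
  rw [norm_mul, norm_zpow, norm_div, hconj, RCLike.norm_conj,
    div_self (norm_ne_zero_iff.2 (ofReal_add_I_mul_ne_zero hu.ne' x)), one_zpow, mul_one,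
    Complex.norm_cpow_eq_rpow_re_of_pos hpos, hs, Real.sqrt_eq_rpow]

theorem norm_deriv_cpow_mul_zpow_le (hu : 0 < u) {s : ℂ} (hs : s.re = 1 / 2) (p : ℤ) (x : ℝ) :
    ‖((u / (x ^ 2 + u ^ 2) : ℝ) : ℂ) ^ s *
        (((x : ℂ) - Complex.I * u) / ((x : ℂ) + Complex.I * u)) ^ p *
        ((-2 * s * x + 2 * p * Complex.I * u) / ((x ^ 2 + u ^ 2 : ℝ) : ℂ))‖ ≤
      √u * (2 * ‖s‖ + 2 * |(p : ℝ)|) * (1 + (u ^ 2)⁻¹) * (1 + x ^ 2)⁻¹ := by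
  have hq : 0 < x ^ 2 + u ^ 2 := by positivity
  have hr : 0 < √(x ^ 2 + u ^ 2) := Real.sqrt_pos.2 hq
  have hnum : ‖-2 * s * x + 2 * p * Complex.I * u‖ ≤
      (2 * ‖s‖ + 2 * |(p : ℝ)|) * √(x ^ 2 + u ^ 2) := by
    have hx : |x| ≤ √(x ^ 2 + u ^ 2) := Real.abs_le_sqrt (by nlinarith)
    have hu' : |u| ≤ √(x ^ 2 + u ^ 2) := Real.abs_le_sqrt (by nlinarith)
    calc _ ≤ ‖-2 * s * x‖ + ‖2 * p * Complex.I * u‖ := norm_add_le _ _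
      _ = 2 * ‖s‖ * |x| + 2 * |(p : ℝ)| * |u| := by simp
      _ ≤ 2 * ‖s‖ * √(x ^ 2 + u ^ 2) + 2 * |(p : ℝ)| * √(x ^ 2 + u ^ 2) := by gcongr
      _ = _ := by ring
  have hden : (x ^ 2 + u ^ 2)⁻¹ ≤ (1 + (u ^ 2)⁻¹) * (1 + x ^ 2)⁻¹ := by
    rw [← div_eq_mul_inv, inv_eq_one_div, div_le_div_iff₀ hq (by positivity)]
    have h : (1 + (u ^ 2)⁻¹) * (x ^ 2 + u ^ 2) = 1 + x ^ 2 + (u ^ 2 + x ^ 2 * (u ^ 2)⁻¹) := by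
      field_simp
      ring
    rw [h, one_mul]
    have : 0 ≤ u ^ 2 + x ^ 2 * (u ^ 2)⁻¹ := by positivity
    linarith
  rw [norm_mul, norm_cpow_mul_zpow hu hs, norm_div, Complex.norm_of_nonneg hq.le,
    Real.sqrt_div hu.le]
  calc _ ≤ √u / √(x ^ 2 + u ^ 2) *
        ((2 * ‖s‖ + 2 * |(p : ℝ)|) * √(x ^ 2 + u ^ 2) / (x ^ 2 + u ^ 2)) := by gcongr
    _ = √u * (2 * ‖s‖ + 2 * |(p : ℝ)|) * (x ^ 2 + u ^ 2)⁻¹ := by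
      generalize √(x ^ 2 + u ^ 2) = r at hr
      field_simp
    _ ≤ √u * (2 * ‖s‖ + 2 * |(p : ℝ)|) * ((1 + (u ^ 2)⁻¹) * (1 + x ^ 2)⁻¹) := by gcongr
    _ = _ := by ring

theorem integrable_deriv_cpow_mul_zpow (hu : 0 < u) {s : ℂ} (hs : s.re = 1 / 2) (p : ℤ) :
    Integrable fun x : ℝ => ((u / (x ^ 2 + u ^ 2) : ℝ) : ℂ) ^ s *
        (((x : ℂ) - Complex.I * u) / ((x : ℂ) + Complex.I * u)) ^ p *
        ((-2 * s * x + 2 * p * Complex.I * u) / ((x ^ 2 + u ^ 2 : ℝ) : ℂ)) := by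
  refine (integrable_inv_one_add_sq.const_mul _).mono' ?_
    (Eventually.of_forall (norm_deriv_cpow_mul_zpow_le hu hs p))
  have hF : Continuous fun x : ℝ => ((u / (x ^ 2 + u ^ 2) : ℝ) : ℂ) ^ s *
      (((x : ℂ) - Complex.I * u) / ((x : ℂ) + Complex.I * u)) ^ p :=
    continuous_iff_continuousAt.2 fun x => (hasDerivAt_cpow_mul_zpow hu s p x).continuousAt
  have hq : ∀ x : ℝ, ((x ^ 2 + u ^ 2 : ℝ) : ℂ) ≠ 0 := fun x =>
    Complex.ofReal_ne_zero.2 (by positivity)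
  exact (hF.mul (Continuous.div (by fun_prop) (by fun_prop) hq)).aestronglyMeasurable

theorem tendsto_cpow_mul_zpow (hu : 0 < u) {s : ℂ} (hs : s.re = 1 / 2) (p : ℤ) {l : Filter ℝ}
    (hl : Tendsto (fun x : ℝ => x ^ 2) l atTop) :
    Tendsto (fun x : ℝ => ((u / (x ^ 2 + u ^ 2) : ℝ) : ℂ) ^ s *
        (((x : ℂ) - Complex.I * u) / ((x : ℂ) + Complex.I * u)) ^ p) l (nhds 0) := by
  rw [tendsto_zero_iff_norm_tendsto_zero]
  simp_rw [norm_cpow_mul_zpow hu hs]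
  have h := ((tendsto_atTop_add_const_right l (u ^ 2) hl).const_div_atTop u).sqrt
  rwa [Real.sqrt_zero] at h

end Kernel

/-- For every purely imaginary `ν ∈ ℂ`, every integer `p`, every sign
`δ ∈ {1, -1}` and every `u > 0`, the improper integral
`lim_{T→∞} ∫_{-T}^{T} e^{-2πiδx} (u/(x²+u²))^{ν+1/2} ((x-iu)/(x+iu))^p dx`
exists, i.e. the limit converges in `ℂ`. -/
theorem statement0 (ν : ℂ) (hν : ν.re = 0) (p : ℤ) (δ : ℝ) (hδ : δ = 1 ∨ δ = -1)
    (u : ℝ) (hu : 0 < u) :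
    ∃ L : ℂ, Tendsto
      (fun T : ℝ => ∫ x : ℝ in (-T)..T,
        Complex.exp (-(2 * (Real.pi : ℂ) * Complex.I * (δ : ℂ) * (x : ℂ))) *
          ((u / (x ^ 2 + u ^ 2) : ℝ) : ℂ) ^ (ν + 1 / 2) *
          (((x : ℂ) - Complex.I * (u : ℂ)) / ((x : ℂ) + Complex.I * (u : ℂ))) ^ p)
      atTop (nhds L) := by
  have hs : (ν + 1 / 2).re = 1 / 2 := by simp [hν]
  have hδ0 : δ ≠ 0 := by rcases hδ with rfl | rfl <;> norm_num
  have hc : -(2 * (Real.pi : ℂ) * Complex.I * (δ : ℂ)) ≠ 0 := by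
    simp [hδ0, Real.pi_ne_zero]
  have hsq : Tendsto (fun x : ℝ => x ^ 2) atBot atTop := by
    simpa [Function.comp_def] using
      (tendsto_pow_atTop (α := ℝ) two_ne_zero).comp tendsto_neg_atBot_atTop
  obtain ⟨L, hL⟩ := exists_tendsto_intervalIntegral_exp_mul hc (by simp)
    (hasDerivAt_cpow_mul_zpow hu (ν + 1 / 2) p) (integrable_deriv_cpow_mul_zpow hu hs p)
    (tendsto_cpow_mul_zpow hu hs p (tendsto_pow_atTop two_ne_zero))
    (tendsto_cpow_mul_zpow hu hs p hsq)
  refine ⟨L, ?_⟩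
  simpa only [neg_mul, mul_assoc] using hL
end

section
/- Let ν ∈ ℂ be purely imaginary, p ∈ ℤ, and α ∈ ℂ with Re α > 1. Then (1/π) ∫₀^∞ u^{α−1} e^{−2πu} · conj( A⁺φ_p(u;ν) ) du = (−1)^p · 2^{−2α} · π^{−ν−α−1/2} · Γ(α+ν+1/2) Γ(α−ν+1/2) / ( Γ(1/2−ν+p) Γ(α+1−p) ), where Γ is the complex Gamma function and conj denotes complex conjugation. -/
open MeasureTheory Filter

open MeasureTheory Filter

/-- `A^δ φ_p(u; ν)`: the improper-integral value at `a[u]` (for `u > 0`) of the Fourier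
transform of the principal-series basis vector `φ_p(g; ν) = y^{ν+1/2} e^{2ipθ}`,
`A^δφ_p(u;ν) = lim_{T→∞} ∫_{-T}^{T} e^{-2πiδx} (u/(x²+u²))^{ν+1/2} ((x-iu)/(x+iu))^p dx`. -/
noncomputable def Aphi (ν : ℂ) (p : ℤ) (δ : ℝ) (u : ℝ) : ℂ :=
  limUnder atTop (fun T : ℝ => ∫ x : ℝ in (-T)..T,
    Complex.exp (-(2 * (Real.pi : ℂ) * Complex.I * (δ : ℂ) * (x : ℂ))) *
      ((u / (x ^ 2 + u ^ 2) : ℝ) : ℂ) ^ (ν + 1 / 2) *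
      (((x : ℂ) - Complex.I * (u : ℂ)) / ((x : ℂ) + Complex.I * (u : ℂ))) ^ p)

/-- The Kirillov-model function `f_p(u) = A^{sgn u} φ_p(|u|; ν)` on `ℝ∖{0}`. -/
noncomputable def kirF (ν : ℂ) (p : ℤ) (u : ℝ) : ℂ := Aphi ν p (Real.sign u) |u|

/-- The measure `dμ(u) = du/(π|u|)` on `ℝ` (the point `0` carries no mass). -/
noncomputable def kirMeasure : Measure ℝ :=
  volume.withDensity fun u => ENNReal.ofReal (1 / (Real.pi * |u|))

section

open Set Topology Complex

/-- The kernel `(1 + it)^(-a) (1 - it)^(-b)` of Cauchy's beta integral. -/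
noncomputable def cauchyKernel (a b : ℂ) (t : ℝ) : ℂ :=
  (1 + t * I) ^ (-a) * (1 - t * I) ^ (-b)

lemma one_add_mul_I_mem_slitPlane (t : ℝ) : (1 + t * I : ℂ) ∈ slitPlane :=
  Or.inl (by simp)

lemma one_sub_mul_I_mem_slitPlane (t : ℝ) : (1 - t * I : ℂ) ∈ slitPlane :=
  Or.inl (by simp)

lemma continuous_cauchyKernel (a b : ℂ) : Continuous (cauchyKernel a b) := by
  refine Continuous.mul ?_ ?_
  · exact Continuous.cpow (by fun_prop) continuous_const one_add_mul_I_mem_slitPlane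
  · exact Continuous.cpow (by fun_prop) continuous_const one_sub_mul_I_mem_slitPlane

lemma norm_cpow_le_norm_rpow_mul_exp (z a : ℂ) :
    ‖z ^ a‖ ≤ ‖z‖ ^ a.re * Real.exp (Real.pi * |a.im|) := by
  refine (norm_cpow_le z a).trans ?_
  rw [div_eq_mul_inv, ← Real.exp_neg]
  gcongr
  calc -(z.arg * a.im) ≤ |z.arg * a.im| := neg_le_abs _
    _ = |z.arg| * |a.im| := abs_mul _ _
    _ ≤ _ := by gcongr; exact abs_arg_le_pi z

lemma norm_one_add_mul_I (t : ℝ) : ‖(1 + t * I : ℂ)‖ = (1 + t ^ 2) ^ (1 / 2 : ℝ) := by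
  rw [← Real.sqrt_eq_rpow, ← Complex.ofReal_one, norm_add_mul_I]; simp

lemma norm_one_sub_mul_I (t : ℝ) : ‖(1 - t * I : ℂ)‖ = (1 + t ^ 2) ^ (1 / 2 : ℝ) := by
  have := norm_one_add_mul_I (-t)
  simpa [sub_eq_add_neg] using this

lemma exists_norm_cauchyKernel_le (a b : ℂ) :
    ∃ C : ℝ, 0 ≤ C ∧ ∀ t, ‖cauchyKernel a b t‖ ≤ C * (1 + ‖t‖ ^ 2) ^ (-(a + b).re / 2) := by
  refine ⟨Real.exp (Real.pi * |(-a).im|) * Real.exp (Real.pi * |(-b).im|), by positivity,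
    fun t => ?_⟩
  have hpos : (0 : ℝ) < 1 + t ^ 2 := by positivity
  rw [cauchyKernel, norm_mul]
  refine (mul_le_mul (norm_cpow_le_norm_rpow_mul_exp _ _) (norm_cpow_le_norm_rpow_mul_exp _ _)
    (norm_nonneg _) (by positivity)).trans (le_of_eq ?_)
  have : (1 + ‖t‖ ^ 2) ^ (-(a + b).re / 2) =
      (1 + t ^ 2) ^ (1 / 2 * (-a).re) * (1 + t ^ 2) ^ (1 / 2 * (-b).re) := by
    rw [← Real.rpow_add hpos, Real.norm_eq_abs, sq_abs]
    congr 1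
    simp
    ring
  rw [this, norm_one_add_mul_I, norm_one_sub_mul_I, ← Real.rpow_mul hpos.le,
    ← Real.rpow_mul hpos.le]
  ring

lemma integrable_cauchyKernel {a b : ℂ} (h : 1 < (a + b).re) : Integrable (cauchyKernel a b) := by
  obtain ⟨C, -, hC⟩ := exists_norm_cauchyKernel_le a b
  refine Integrable.mono' ((integrable_rpow_neg_one_add_norm_sq (E := ℝ) (μ := volume)
    (by simpa using h)).const_mul C) (continuous_cauchyKernel a b).aestronglyMeasurable ?_
  exact Eventually.of_forall hC

lemma tendsto_cauchyKernel_zero {a b : ℂ} (h : 0 < (a + b).re) {l : Filter ℝ}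
    (hl : Tendsto (fun t : ℝ => ‖t‖) l atTop) : Tendsto (cauchyKernel a b) l (𝓝 0) := by
  obtain ⟨C, -, hC⟩ := exists_norm_cauchyKernel_le a b
  refine squeeze_zero_norm hC ?_
  rw [← mul_zero C]
  refine Tendsto.const_mul C ?_
  simp_rw [neg_div]
  refine (tendsto_rpow_neg_atTop (y := (a + b).re / 2) (by linarith)).comp ?_
  exact tendsto_atTop_add_const_left _ _ ((tendsto_pow_atTop (by norm_num)).comp hl)

lemma hasDerivAt_cauchyKernel (a b : ℂ) (t : ℝ) :
    HasDerivAt (cauchyKernel a b)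
      (I * (b * cauchyKernel a (b + 1) t - a * cauchyKernel (a + 1) b t)) t := by
  have h1 : HasDerivAt (fun z : ℂ => 1 + z * I) I t := by
    simpa using ((hasDerivAt_id (t : ℂ)).mul_const I).const_add (1 : ℂ)
  have h2 : HasDerivAt (fun z : ℂ => 1 - z * I) (-I) t := by
    simpa using ((hasDerivAt_id (t : ℂ)).mul_const I).const_sub (1 : ℂ)
  have h3 := ((h1.cpow_const (c := -a) (one_add_mul_I_mem_slitPlane t)).mul
    (h2.cpow_const (c := -b) (one_sub_mul_I_mem_slitPlane t))).comp_ofReal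
  refine h3.congr_deriv ?_
  simp only [cauchyKernel, neg_add']
  ring

lemma cpow_add_one_of_ne_zero {z : ℂ} (hz : z ≠ 0) (a : ℂ) : z ^ (a + 1) = z ^ a * z := by
  rw [cpow_add _ _ hz, cpow_one]

lemma norm_exp_neg_two_pi_I_mul (u t : ℝ) :
    ‖exp (-(2 * (Real.pi : ℂ) * I * u * t))‖ = 1 := by
  rw [norm_exp]
  simp

lemma tendsto_and_norm_integral_exp_mul_cauchyKernel {a b : ℂ} (h : 0 < (a + b).re) :
    ∃ C : ℝ, ∀ u : ℝ, 0 < u →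
      (∃ L, Tendsto (fun R : ℝ => ∫ t in (-R)..R,
        exp (-(2 * (Real.pi : ℂ) * I * u * t)) * cauchyKernel a b t) atTop (𝓝 L)) ∧
      ∀ R : ℝ, ‖∫ t in (-R)..R, exp (-(2 * (Real.pi : ℂ) * I * u * t)) * cauchyKernel a b t‖
        ≤ C * u⁻¹ := by
  obtain ⟨C, hC0, hC⟩ := exists_norm_cauchyKernel_le a b
  have hC' : ∀ t, ‖cauchyKernel a b t‖ ≤ C := fun t => (hC t).trans <| by
    refine mul_le_of_le_one_right hC0 (Real.rpow_le_one_of_one_le_of_nonpos ?_ ?_)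
    · nlinarith [sq_nonneg ‖t‖]
    · linarith
  set K' : ℝ → ℂ := fun t =>
    I * (b * cauchyKernel a (b + 1) t - a * cauchyKernel (a + 1) b t) with hK'
  have hK'int : Integrable K' := by
    refine ((Integrable.const_mul ?_ _).sub (Integrable.const_mul ?_ _)).const_mul _
    · exact integrable_cauchyKernel (by simp at h ⊢; linarith)
    · exact integrable_cauchyKernel (by simp at h ⊢; linarith)
  have hK'cont : Continuous K' := by
    have := continuous_cauchyKernel a (b + 1)
    have := continuous_cauchyKernel (a + 1) b
    fun_prop
  refine ⟨(C + C + ∫ t, ‖K' t‖) * (2 * Real.pi)⁻¹, fun u hu => ?_⟩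
  set v : ℝ → ℂ := fun t =>
    exp (-(2 * (Real.pi : ℂ) * I * u * t)) / (-(2 * (Real.pi : ℂ) * I * u)) with hv
  have hu' : (-(2 * (Real.pi : ℂ) * I * u)) ≠ 0 := by
    simp [Real.pi_ne_zero, hu.ne']
  have hvnorm : ∀ t, ‖v t‖ = (2 * Real.pi)⁻¹ * u⁻¹ := fun t => by
    rw [hv]
    simp only [norm_div, norm_exp_neg_two_pi_I_mul]
    simp [abs_of_pos Real.pi_pos, abs_of_pos hu]
    ring
  have hvderiv : ∀ t : ℝ, HasDerivAt v (exp (-(2 * (Real.pi : ℂ) * I * u * t))) t := fun t => by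
    have h1 : HasDerivAt (fun z : ℂ => -(2 * (Real.pi : ℂ) * I * u * z))
        (-(2 * (Real.pi : ℂ) * I * u)) t := by
      simpa using ((hasDerivAt_id (t : ℂ)).const_mul (2 * (Real.pi : ℂ) * I * u)).fun_neg
    refine (h1.cexp.div_const (-(2 * (Real.pi : ℂ) * I * u))).comp_ofReal.congr_deriv ?_
    exact mul_div_cancel_right₀ _ hu'
  have hvcont : Continuous v := by fun_prop
  have hintegrable : Integrable (fun t => K' t * v t) := by
    refine Integrable.mono' (hK'int.norm.mul_const ((2 * Real.pi)⁻¹ * u⁻¹))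
      (hK'cont.mul hvcont).aestronglyMeasurable (Eventually.of_forall fun t => ?_)
    rw [norm_mul, hvnorm]
  have hparts : ∀ R : ℝ, ∫ t in (-R)..R,
      exp (-(2 * (Real.pi : ℂ) * I * u * t)) * cauchyKernel a b t =
      cauchyKernel a b R * v R - cauchyKernel a b (-R) * v (-R) -
        ∫ t in (-R)..R, K' t * v t := fun R => by
    rw [← intervalIntegral.integral_mul_deriv_eq_deriv_mul
      (fun t _ => hasDerivAt_cauchyKernel a b t) (fun t _ => hvderiv t)
      hK'int.intervalIntegrable ((by fun_prop : Continuous fun t : ℝ =>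
        exp (-(2 * (Real.pi : ℂ) * I * u * t))).intervalIntegrable _ _)]
    simp_rw [mul_comm]
  simp_rw [hparts]
  constructor
  · refine ⟨0 - 0 - ∫ t, K' t * v t, Tendsto.sub (Tendsto.sub ?_ ?_) ?_⟩
    · refine squeeze_zero_norm (a := fun R => ‖cauchyKernel a b R‖ * ((2 * Real.pi)⁻¹ * u⁻¹))
        (fun R => by rw [norm_mul, hvnorm]) ?_
      simpa using (tendsto_cauchyKernel_zero h tendsto_norm_atTop_atTop).norm.mul_const
        ((2 * Real.pi)⁻¹ * u⁻¹)
    · refine squeeze_zero_norm (a := fun R => ‖cauchyKernel a b (-R)‖ * ((2 * Real.pi)⁻¹ * u⁻¹))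
        (fun R => by rw [norm_mul, hvnorm]) ?_
      simpa using ((tendsto_cauchyKernel_zero h tendsto_abs_atBot_atTop).comp
        tendsto_neg_atTop_atBot).norm.mul_const ((2 * Real.pi)⁻¹ * u⁻¹)
    · exact intervalIntegral_tendsto_integral hintegrable tendsto_neg_atTop_atBot tendsto_id
  · intro R
    have h1 : ∀ s, ‖cauchyKernel a b s * v s‖ ≤ C * ((2 * Real.pi)⁻¹ * u⁻¹) := fun s => by
      rw [norm_mul, hvnorm]
      gcongr
      exact hC' s
    have h2 : ‖∫ t in (-R)..R, K' t * v t‖ ≤ (∫ t, ‖K' t‖) * ((2 * Real.pi)⁻¹ * u⁻¹) := by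
      refine intervalIntegral.norm_integral_le_integral_norm_uIoc.trans ?_
      refine (setIntegral_le_integral hintegrable.norm (Eventually.of_forall fun t => norm_nonneg _)).trans
        (le_of_eq ?_)
      simp_rw [norm_mul, hvnorm]
      rw [integral_mul_const]
    refine (norm_sub_le _ _).trans ((add_le_add ((norm_sub_le _ _).trans
      (add_le_add (h1 _) (h1 _))) h2).trans (le_of_eq ?_))
    ring

lemma norm_cpow_mul_exp_neg (a : ℂ) (r x : ℝ) {u : ℝ} (hu : 0 < u) :
    ‖(u : ℂ) ^ (a - 1) * exp (-(r * (1 + x * I) * u))‖ =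
      u ^ (a.re - 1) * Real.exp (-r * u) := by
  rw [norm_mul, norm_cpow_eq_rpow_re_of_pos hu, norm_exp]
  simp

lemma integrableOn_rpow_mul_exp_neg {s r : ℝ} (hs : 0 < s) (hr : 0 < r) :
    IntegrableOn (fun u : ℝ => u ^ (s - 1) * Real.exp (-r * u)) (Ioi 0) := by
  simpa using integrableOn_rpow_mul_exp_neg_mul_rpow (p := 1) (s := s - 1) (by linarith)
    one_pos hr

lemma continuousOn_cpow_mul_exp_neg (a : ℂ) (r x : ℝ) :
    ContinuousOn (fun u : ℝ => (u : ℂ) ^ (a - 1) * exp (-(r * (1 + x * I) * u))) (Ioi 0) := by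
  intro u hu
  refine ContinuousAt.continuousWithinAt (ContinuousAt.mul ?_ (by fun_prop))
  exact continuousAt_ofReal_cpow_const _ _ (Or.inr (ne_of_gt hu))

lemma integrableOn_cpow_mul_exp_neg {a : ℂ} {r : ℝ} (ha : 0 < a.re) (hr : 0 < r) (x : ℝ) :
    IntegrableOn (fun u : ℝ => (u : ℂ) ^ (a - 1) * exp (-(r * (1 + x * I) * u))) (Ioi 0) := by
  refine Integrable.mono' (integrableOn_rpow_mul_exp_neg ha hr)
    ((continuousOn_cpow_mul_exp_neg a r x).aestronglyMeasurable measurableSet_Ioi) ?_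
  filter_upwards [ae_restrict_mem measurableSet_Ioi] with u hu
  rw [norm_cpow_mul_exp_neg a r x hu]

lemma integral_cpow_mul_exp_neg_succ {a : ℂ} {r : ℝ} (ha : 0 < a.re) (hr : 0 < r) (x : ℝ) :
    a * ∫ u : ℝ in Ioi 0, (u : ℂ) ^ (a - 1) * exp (-(r * (1 + x * I) * u)) =
      r * (1 + x * I) *
        ∫ u : ℝ in Ioi 0, (u : ℂ) ^ (a + 1 - 1) * exp (-(r * (1 + x * I) * u)) := by
  have ha0 : a ≠ 0 := fun h => by simp [h] at ha
  have i1 := (integrableOn_cpow_mul_exp_neg ha hr x).const_mul a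
  have i2 := (integrableOn_cpow_mul_exp_neg (a := a + 1) (by simp; linarith) hr x).const_mul
    (r * (1 + x * I))
  have hderiv : ∀ u ∈ Ioi (0 : ℝ), HasDerivAt
      (fun u : ℝ => (u : ℂ) ^ a * exp (-(r * (1 + x * I) * u)))
      (a * ((u : ℂ) ^ (a - 1) * exp (-(r * (1 + x * I) * u))) -
        r * (1 + x * I) * ((u : ℂ) ^ (a + 1 - 1) * exp (-(r * (1 + x * I) * u)))) u := by
    intro u hu
    have h1 : HasDerivAt (fun z : ℂ => -(r * (1 + x * I) * z)) (-(r * (1 + x * I))) u := by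
      simpa using ((hasDerivAt_id (u : ℂ)).const_mul (r * (1 + x * I))).fun_neg
    have h2 := (((hasDerivAt_id (u : ℂ)).cpow_const (c := a)
      (ofReal_mem_slitPlane.2 hu)).mul h1.cexp).comp_ofReal
    refine h2.congr_deriv ?_
    simp only [id, add_sub_cancel_right]
    ring
  have hnorm : ∀ u : ℝ, 0 < u → ‖(u : ℂ) ^ a * exp (-(r * (1 + x * I) * u))‖ =
      u ^ a.re * Real.exp (-r * u) := fun u hu => by
    have := norm_cpow_mul_exp_neg (a + 1) r x hu
    simpa using this
  have key := integral_Ioi_of_hasDerivAt_of_tendsto (a := (0 : ℝ)) (m := 0)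
    (f := fun u : ℝ => (u : ℂ) ^ a * exp (-(r * (1 + x * I) * u))) ?_ hderiv (i1.sub i2) ?_
  · rw [integral_sub i1 i2, integral_const_mul, integral_const_mul] at key
    simpa [ha0, sub_eq_zero] using key
  · refine ContinuousAt.continuousWithinAt (ContinuousAt.mul ?_ (by fun_prop))
    exact continuousAt_ofReal_cpow_const _ _ (Or.inl ha)
  · refine squeeze_zero_norm' (a := fun u => u ^ a.re * Real.exp (-r * u)) ?_
      (tendsto_rpow_mul_exp_neg_mul_atTop_nhds_zero a.re r hr)
    filter_upwards [eventually_gt_atTop 0] with u hu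
    rw [hnorm u hu]

lemma hasDerivAt_integral_cpow_mul_exp_neg {a : ℂ} {r : ℝ} (ha : 0 < a.re) (hr : 0 < r) (x : ℝ) :
    HasDerivAt
      (fun x : ℝ => ∫ u : ℝ in Ioi 0, (u : ℂ) ^ (a - 1) * exp (-(r * (1 + x * I) * u)))
      (-(r * I) * ∫ u : ℝ in Ioi 0, (u : ℂ) ^ (a + 1 - 1) * exp (-(r * (1 + x * I) * u))) x := by
  rw [← integral_const_mul]
  refine (hasDerivAt_integral_of_dominated_loc_of_deriv_le (s := univ)
    (F' := fun x u => -(r * I) * ((u : ℂ) ^ (a + 1 - 1) * exp (-(r * (1 + x * I) * u))))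
    (bound := fun u => r * (u ^ ((a + 1).re - 1) * Real.exp (-r * u)))
    univ_mem (Eventually.of_forall fun x => (integrableOn_cpow_mul_exp_neg ha hr x).1)
    (integrableOn_cpow_mul_exp_neg ha hr x)
    ((integrableOn_cpow_mul_exp_neg (a := a + 1) (by simp; linarith) hr x).1.const_mul _) ?_
    ((integrableOn_rpow_mul_exp_neg (by simp; linarith) hr).const_mul _) ?_).2
  · filter_upwards [ae_restrict_mem measurableSet_Ioi] with u hu y _
    rw [norm_mul, norm_cpow_mul_exp_neg (a + 1) r y hu]
    simp [abs_of_pos hr]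
  · filter_upwards [ae_restrict_mem measurableSet_Ioi] with u hu y _
    have h1 : HasDerivAt (fun z : ℂ => -(r * (1 + z * I) * u)) (-(r * I * u)) y := by
      simpa using (((((hasDerivAt_id (y : ℂ)).mul_const I).const_add 1).const_mul
        (r : ℂ)).mul_const (u : ℂ)).fun_neg
    refine ((h1.cexp.const_mul ((u : ℂ) ^ (a - 1))).comp_ofReal).congr_deriv ?_
    have : (u : ℂ) ^ (a + 1 - 1) = (u : ℂ) ^ (a - 1) * u := by
      rw [← cpow_add_one_of_ne_zero (ofReal_ne_zero.2 (ne_of_gt hu))]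
      ring_nf
    rw [this]
    ring

/-- Euler's integral for the Gamma function along a vertical line of exponents. -/
lemma integral_cpow_mul_exp_neg_one_add_mul_I {a : ℂ} {r : ℝ} (ha : 0 < a.re) (hr : 0 < r)
    (x : ℝ) :
    ∫ u : ℝ in Ioi 0, (u : ℂ) ^ (a - 1) * exp (-(r * (1 + x * I) * u)) =
      (1 / r) ^ a * Gamma a * (1 + x * I) ^ (-a) := by
  set F : ℝ → ℂ := fun x => ∫ u : ℝ in Ioi 0, (u : ℂ) ^ (a - 1) * exp (-(r * (1 + x * I) * u))
  have hne : ∀ x : ℝ, (1 + x * I : ℂ) ≠ 0 := fun x =>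
    slitPlane_ne_zero (one_add_mul_I_mem_slitPlane x)
  have hderiv : ∀ x : ℝ, HasDerivAt (fun x : ℝ => F x * (1 + x * I) ^ a) 0 x := fun x => by
    have h1 : HasDerivAt (fun z : ℂ => 1 + z * I) I x := by
      simpa using ((hasDerivAt_id (x : ℂ)).mul_const I).const_add (1 : ℂ)
    refine ((hasDerivAt_integral_cpow_mul_exp_neg ha hr x).mul
      (h1.cpow_const (c := a) (one_add_mul_I_mem_slitPlane x)).comp_ofReal).congr_deriv ?_
    have h2 := integral_cpow_mul_exp_neg_succ ha hr x
    have h3 : (1 + x * I : ℂ) ^ a = (1 + x * I) ^ (a - 1) * (1 + x * I) := by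
      rw [← cpow_add_one_of_ne_zero (hne x), sub_add_cancel]
    rw [h3]
    linear_combination (1 + x * I : ℂ) ^ (a - 1) * I * h2
  have hconst := is_const_of_deriv_eq_zero (fun x => (hderiv x).differentiableAt)
    (fun x => (hderiv x).deriv) x 0
  have hF0 : F 0 = (1 / r) ^ a * Gamma a := by
    simpa [F] using integral_cpow_mul_exp_neg_mul_Ioi ha hr
  simp only [ofReal_zero, zero_mul, add_zero, one_cpow, mul_one, hF0] at hconst
  rw [← hconst, mul_assoc, ← cpow_add _ _ (hne x), add_neg_cancel, cpow_zero, mul_one]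

/-- The function `u ↦ u^(a-1) e^(-2πu)` on the positive half-line, extended by zero. -/
noncomputable def gammaWeight (a : ℂ) : ℝ → ℂ :=
  (Ioi 0).indicator fun u => (u : ℂ) ^ (a - 1) * exp (-(2 * Real.pi * u))

lemma integrable_gammaWeight {a : ℂ} (ha : 0 < a.re) : Integrable (gammaWeight a) := by
  have := integrableOn_cpow_mul_exp_neg ha Real.two_pi_pos 0
  rw [gammaWeight, integrable_indicator_iff measurableSet_Ioi]
  simpa using this

lemma continuous_gammaWeight {a : ℂ} (ha : 1 < a.re) : Continuous (gammaWeight a) := by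
  have ha' : 0 < (a - 1).re := by simpa using ha
  refine Continuous.indicator (fun u hu => ?_) ?_
  · rw [frontier_Ioi] at hu
    have : a - 1 ≠ 0 := fun h => by simp [h] at ha'
    simp [mem_singleton_iff.1 hu, zero_cpow this]
  · exact (continuous_ofReal_cpow_const ha').mul (by fun_prop)

open scoped FourierTransform in
lemma fourier_gammaWeight {a : ℂ} (ha : 0 < a.re) (ξ : ℝ) :
    𝓕 (gammaWeight a) ξ = (1 / (2 * Real.pi : ℝ)) ^ a * Gamma a * (1 + ξ * I) ^ (-a) := by
  rw [← integral_cpow_mul_exp_neg_one_add_mul_I ha Real.two_pi_pos ξ,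
    Real.fourier_real_eq_integral_exp_smul, ← integral_indicator measurableSet_Ioi]
  congr 1
  ext u
  by_cases hu : u ∈ Ioi (0 : ℝ)
  · simp only [gammaWeight, indicator_of_mem hu, smul_eq_mul]
    rw [mul_left_comm, ← exp_add]
    congr 2
    push_cast
    ring
  · simp [gammaWeight, indicator_of_notMem hu]

open scoped FourierTransform in
lemma fourier_one_sub_mul_I_cpow {b : ℂ} (hb : 1 < b.re) (u : ℝ) :
    (1 / (2 * Real.pi : ℝ)) ^ b * Gamma b * 𝓕 (fun ξ : ℝ => (1 - ξ * I : ℂ) ^ (-b)) u =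
      gammaWeight b u := by
  have hb0 : 0 < b.re := by linarith
  have hF : 𝓕 (gammaWeight b) = fun ξ : ℝ =>
      (1 / (2 * Real.pi : ℝ)) ^ b * Gamma b * cauchyKernel b 0 ξ := by
    ext ξ
    rw [fourier_gammaWeight hb0, cauchyKernel, neg_zero, cpow_zero, mul_one]
  have hintegrable : Integrable (𝓕 (gammaWeight b)) := by
    rw [hF]
    exact (integrable_cauchyKernel (by simpa using hb)).const_mul _
  rw [← congrFun ((continuous_gammaWeight hb).fourierInv_fourier_eq
    (integrable_gammaWeight hb0) hintegrable) u, Real.fourierInv_eq_fourier_neg, hF,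
    Real.fourier_real_eq_integral_exp_smul, Real.fourier_real_eq_integral_exp_smul,
    ← integral_const_mul, ← integral_neg_eq_self]
  congr 1
  ext ξ
  simp only [cauchyKernel, neg_zero, cpow_zero, mul_one, smul_eq_mul]
  push_cast
  ring_nf

/-- Cauchy's beta integral for exponents of real part greater than one. -/
lemma integral_cauchyKernel_of_one_lt {a b : ℂ} (ha : 1 < a.re) (hb : 1 < b.re) :
    ∫ t, cauchyKernel a b t =
      2 * Real.pi * (1 / 2) ^ (a + b - 1) * Gamma (a + b - 1) / (Gamma a * Gamma b) := by
  have ha0 : 0 < a.re := by linarith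
  have hb0 : 0 < b.re := by linarith
  have hGa : Gamma a ≠ 0 := Gamma_ne_zero_of_re_pos ha0
  have hGb : Gamma b ≠ 0 := Gamma_ne_zero_of_re_pos hb0
  have hg : Integrable (fun ξ : ℝ => (1 - ξ * I : ℂ) ^ (-b)) := by
    have := integrable_cauchyKernel (a := 0) (b := b) (by simpa using hb)
    convert! this using 2 with ξ
    simp [cauchyKernel]
  have hflip := VectorFourier.integral_fourierIntegral_smul_eq_flip (L := innerₗ ℝ)
    (μ := volume) (ν := volume) Real.continuous_fourierChar continuous_inner
    (integrable_gammaWeight ha0) hg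
  have h1 : ∫ ξ : ℝ, (1 / (2 * Real.pi : ℝ)) ^ a * Gamma a * cauchyKernel a b ξ =
      ∫ u : ℝ, gammaWeight a u *
        FourierTransform.fourier (fun ξ : ℝ => (1 - ξ * I : ℂ) ^ (-b)) u := by
    refine Eq.trans (integral_congr_ae (Eventually.of_forall fun ξ => ?_))
      (hflip.trans (by simp [flip_innerₗ]; rfl))
    have := fourier_gammaWeight ha0 ξ
    change _ = FourierTransform.fourier (gammaWeight a) ξ * _
    simp only [this, cauchyKernel]
    ring
  have h2 : (1 / (2 * Real.pi : ℝ)) ^ b * Gamma b * ∫ u : ℝ, gammaWeight a u *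
        FourierTransform.fourier (fun ξ : ℝ => (1 - ξ * I : ℂ) ^ (-b)) u =
      ∫ u : ℝ in Ioi 0, (u : ℂ) ^ (a + b - 1 - 1) * exp (-((4 * Real.pi : ℝ) * u)) := by
    rw [← integral_const_mul, ← integral_indicator measurableSet_Ioi]
    congr 1
    ext u
    rw [mul_left_comm, fourier_one_sub_mul_I_cpow hb]
    by_cases hu : u ∈ Ioi (0 : ℝ)
    · simp only [gammaWeight, indicator_of_mem hu]
      have hu' : (u : ℂ) ≠ 0 := ofReal_ne_zero.2 (ne_of_gt hu)
      rw [show a + b - 1 - 1 = (a - 1) + (b - 1) by ring, cpow_add _ _ hu',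
        show -(((4 * Real.pi : ℝ) : ℂ) * u) = -(2 * Real.pi * u) + -(2 * Real.pi * u) by
          push_cast; ring, exp_add]
      ring
    · simp [gammaWeight, indicator_of_notMem hu]
  rw [← h1, integral_const_mul, integral_cpow_mul_exp_neg_mul_Ioi
    (by simp; linarith) (by positivity)] at h2
  have h3 : (1 / ((4 * Real.pi : ℝ) : ℂ)) ^ (a + b - 1) =
      (1 / 2) ^ (a + b - 1) * ((1 / (2 * Real.pi : ℝ)) ^ a * (1 / (2 * Real.pi : ℝ)) ^ b *
        (2 * Real.pi : ℝ)) := by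
    have := mul_cpow_ofReal_nonneg (a := 1 / 2) (b := 1 / (2 * Real.pi)) (by norm_num)
      (by positivity) (a + b - 1)
    have e : (1 / ((4 * Real.pi : ℝ) : ℂ)) = ((1 / 2 : ℝ) : ℂ) * ((1 / (2 * Real.pi) : ℝ) : ℂ) := by
      push_cast
      field_simp
      norm_num
    have hq : ((1 / (2 * Real.pi) : ℝ) : ℂ) ≠ 0 := by simp [Real.pi_ne_zero]
    rw [e, this, cpow_sub (a + b) 1 hq, cpow_add a b hq, cpow_one]
    push_cast
    field_simp
  rw [h3] at h2
  have hpa : (1 / ((2 * Real.pi : ℝ) : ℂ)) ^ a ≠ 0 := by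
    rw [Ne, cpow_eq_zero_iff]; simp
  have hpb : (1 / ((2 * Real.pi : ℝ) : ℂ)) ^ b ≠ 0 := by
    rw [Ne, cpow_eq_zero_iff]; simp
  rw [eq_div_iff (mul_ne_zero hGa hGb)]
  refine mul_left_cancel₀ (mul_ne_zero hpa hpb) ?_
  push_cast at h2 ⊢
  linear_combination h2

lemma mul_integral_cauchyKernel {a b : ℂ} (h : 0 < (a + b).re) :
    a * ∫ t, cauchyKernel (a + 1) b t = b * ∫ t, cauchyKernel a (b + 1) t := by
  have i1 := (integrable_cauchyKernel (a := a) (b := b + 1)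
    (by simp at h ⊢; linarith)).const_mul b
  have i2 := (integrable_cauchyKernel (a := a + 1) (b := b)
    (by simp at h ⊢; linarith)).const_mul a
  have key := integral_of_hasDerivAt_of_tendsto (hasDerivAt_cauchyKernel a b)
    ((i1.sub i2).const_mul I) (tendsto_cauchyKernel_zero h tendsto_abs_atBot_atTop)
    (tendsto_cauchyKernel_zero h tendsto_abs_atTop_atTop)
  rw [integral_const_mul, integral_sub i1 i2, integral_const_mul, integral_const_mul] at key
  exact (by simpa [sub_eq_zero] using key : _ = _).symm

/-- Cauchy's beta integral for exponents shifted by an arbitrary integer. -/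
lemma integral_cauchyKernel_shift {a b : ℂ} (ha : 1 < a.re) (hb : 1 < b.re)
    (hb' : ∀ n : ℤ, b + n ≠ 0) (n : ℤ) :
    ∫ t, cauchyKernel (a - n) (b + n) t =
      2 * Real.pi * (1 / 2) ^ (a + b - 1) * Gamma (a + b - 1) /
        (Gamma (a - n) * Gamma (b + n)) := by
  have base := integral_cauchyKernel_of_one_lt ha hb
  have step (n : ℤ) : (a - n - 1) * ∫ t, cauchyKernel (a - n) (b + n) t =
      (b + n) * ∫ t, cauchyKernel (a - (n + 1 : ℤ)) (b + (n + 1 : ℤ)) t := by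
    have := mul_integral_cauchyKernel (a := a - n - 1) (b := b + n) (by simp; linarith)
    rw [sub_add_cancel] at this
    rw [this]
    push_cast
    ring_nf
  have hGb (n : ℤ) : Gamma (b + (n + 1 : ℤ)) = (b + n) * Gamma (b + n) := by
    rw [← Gamma_add_one _ (hb' n)]
    push_cast
    ring_nf
  have hGa (n : ℤ) : (Gamma (a - (n + 1 : ℤ)))⁻¹ = (a - n - 1) * (Gamma (a - n))⁻¹ := by
    rw [one_div_Gamma_eq_self_mul_one_div_Gamma_add_one]
    push_cast
    ring_nf
  generalize 2 * Real.pi * (1 / 2) ^ (a + b - 1) * Gamma (a + b - 1) = K at base ⊢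
  induction n using Int.induction_on with
  | zero => simpa using base
  | succ n ih =>
    have h := step n
    rw [ih] at h
    refine mul_left_cancel₀ (hb' n) ?_
    rw [← h, div_eq_mul_inv, div_eq_mul_inv, mul_inv, mul_inv, hGb, hGa, mul_inv]
    have := hb' n
    field_simp
  | pred n ih =>
    have h := step (-n - 1)
    have hG := hGb (-n - 1)
    have hG' := hGa (-n - 1)
    rw [sub_add_cancel] at h hG hG'
    rw [ih] at h
    have hne : a - ((-n - 1 : ℤ) : ℂ) - 1 ≠ 0 := fun h0 => by
      have := congrArg re h0
      simp at this
      have : (0 : ℝ) ≤ n := n.cast_nonneg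
      linarith
    refine mul_left_cancel₀ hne ?_
    rw [h, div_eq_mul_inv, div_eq_mul_inv, mul_inv, mul_inv, hG, hG', mul_inv]
    have := hb' (-n - 1)
    field_simp

lemma conj_cauchyKernel (a b : ℂ) (t : ℝ) :
    starRingEnd ℂ (cauchyKernel a b t) =
      cauchyKernel (starRingEnd ℂ a) (starRingEnd ℂ b) (-t) := by
  have h1 := cpow_conj (1 - t * I) (-a) (slitPlane_arg_ne_pi (one_sub_mul_I_mem_slitPlane t))
  have h2 := cpow_conj (1 + t * I) (-b) (slitPlane_arg_ne_pi (one_add_mul_I_mem_slitPlane t))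
  simp only [map_sub, map_add, map_one, map_mul, conj_ofReal, conj_I, map_neg] at h1 h2
  rw [mul_neg, sub_neg_eq_add] at h1
  rw [mul_neg, ← sub_eq_add_neg] at h2
  rw [cauchyKernel, cauchyKernel, map_mul, ← h1, ← h2]
  simp [sub_eq_add_neg]

lemma inv_one_add_sq_cpow (s : ℂ) (t : ℝ) :
    (((1 + t ^ 2)⁻¹ : ℝ) : ℂ) ^ s = (1 + t * I) ^ (-s) * (1 - t * I) ^ (-s) := by
  have hpos : (0 : ℝ) < 1 + t ^ 2 := by positivity
  have hlog : log (1 + t * I) + log (1 - t * I) = (Real.log (1 + t ^ 2) : ℂ) := by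
    have h : (1 - t * I : ℂ) = starRingEnd ℂ (1 + t * I) := by simp [sub_eq_add_neg]
    rw [h, log_conj _ (slitPlane_arg_ne_pi (one_add_mul_I_mem_slitPlane t)), add_conj, log_re,
      norm_one_add_mul_I, Real.log_rpow hpos]
    push_cast
    ring
  rw [cpow_def_of_ne_zero (slitPlane_ne_zero (one_add_mul_I_mem_slitPlane t)),
    cpow_def_of_ne_zero (slitPlane_ne_zero (one_sub_mul_I_mem_slitPlane t)),
    cpow_def_of_ne_zero (ofReal_ne_zero.2 (inv_pos.2 hpos).ne'), ← exp_add,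
    ← ofReal_log (inv_pos.2 hpos).le, Real.log_inv]
  congr 1
  push_cast at hlog ⊢
  linear_combination s * hlog

lemma principalSeries_integrand_eq (s : ℂ) (p : ℤ) {u : ℝ} (hu : 0 < u) (t : ℝ) :
    ((u / ((u * t) ^ 2 + u ^ 2) : ℝ) : ℂ) ^ s *
        ((((u * t : ℝ) : ℂ) - I * u) / (((u * t : ℝ) : ℂ) + I * u)) ^ p =
      (u : ℂ) ^ (-s) * (-1) ^ p * cauchyKernel (s - p) (s + p) t := by
  have hpos : (0 : ℝ) < 1 + t ^ 2 := by positivity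
  have h1 := slitPlane_ne_zero (one_add_mul_I_mem_slitPlane t)
  have h2 := slitPlane_ne_zero (one_sub_mul_I_mem_slitPlane t)
  have hu0 : (u : ℂ) ≠ 0 := ofReal_ne_zero.2 hu.ne'
  have e1 : u / ((u * t) ^ 2 + u ^ 2) = u⁻¹ * (1 + t ^ 2)⁻¹ := by
    have : (u * t) ^ 2 + u ^ 2 = u * (u * (1 + t ^ 2)) := by ring
    rw [this]
    field_simp
  have e2 : (((u * t : ℝ) : ℂ) - I * u) / (((u * t : ℝ) : ℂ) + I * u) =
      -1 * ((1 + t * I) / (1 - t * I)) := by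
    have n1 : ((u * t : ℝ) : ℂ) - I * u = -I * u * (1 + t * I) := by
      push_cast
      linear_combination (u * t : ℂ) * I_sq
    have n2 : ((u * t : ℝ) : ℂ) + I * u = I * u * (1 - t * I) := by
      push_cast
      linear_combination (u * t : ℂ) * I_sq
    rw [n1, n2]
    field_simp
  have e3 : ((u⁻¹ : ℝ) : ℂ) ^ s = (u : ℂ) ^ (-s) := by
    rw [ofReal_inv, inv_cpow _ _ (by rw [arg_ofReal_of_nonneg hu.le]; exact Real.pi_ne_zero.symm),
      cpow_neg]
  rw [e1, e2, ofReal_mul, mul_cpow_ofReal_nonneg (inv_pos.2 hu).le (inv_pos.2 hpos).le, e3,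
    inv_one_add_sq_cpow, cauchyKernel, mul_zpow, div_zpow, neg_add,
    show -(s - (p : ℂ)) = -s + p by ring, cpow_add _ _ h1, cpow_add _ _ h2, cpow_intCast,
    cpow_neg _ (p : ℂ), cpow_intCast]
  ring

lemma tendsto_conj_Aphi {ν : ℂ} (hν : ν.re = 0) (p : ℤ) {u : ℝ} (hu : 0 < u) :
    Tendsto (fun R : ℝ => u * (u : ℂ) ^ (-(1 / 2 - ν)) * (-1) ^ p * ∫ t in (-R)..R,
        exp (-(2 * (Real.pi : ℂ) * I * u * t)) *
          cauchyKernel (1 / 2 - ν - p) (1 / 2 - ν + p) t)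
      atTop (𝓝 (starRingEnd ℂ (Aphi ν p 1 u))) := by
  have hconj : starRingEnd ℂ (ν + 1 / 2) = 1 / 2 - ν := by
    apply Complex.ext <;> simp [hν]
  have hconj_u : starRingEnd ℂ ((u : ℂ) ^ (-(ν + 1 / 2))) = (u : ℂ) ^ (-(1 / 2 - ν)) := by
    have := cpow_conj (u : ℂ) (-(ν + 1 / 2))
      (by rw [arg_ofReal_of_nonneg hu.le]; exact Real.pi_ne_zero.symm)
    rw [conj_ofReal] at this
    rw [← this, map_neg, hconj]
  obtain ⟨C, hC⟩ := tendsto_and_norm_integral_exp_mul_cauchyKernel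
    (a := ν + 1 / 2 - p) (b := ν + 1 / 2 + p) (by simp [hν])
  obtain ⟨⟨L, hL⟩, -⟩ := hC u hu
  have hA : Tendsto (fun T : ℝ => ∫ x : ℝ in (-T)..T,
      exp (-(2 * (Real.pi : ℂ) * I * ((1 : ℝ) : ℂ) * (x : ℂ))) *
        ((u / (x ^ 2 + u ^ 2) : ℝ) : ℂ) ^ (ν + 1 / 2) *
        (((x : ℂ) - I * (u : ℂ)) / ((x : ℂ) + I * (u : ℂ))) ^ p) atTop
      (𝓝 (u * (u : ℂ) ^ (-(ν + 1 / 2)) * (-1) ^ p * L)) := by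
    refine ((hL.comp (tendsto_id.atTop_div_const hu)).const_mul _).congr fun T => ?_
    have hsub := intervalIntegral.integral_comp_mul_left (a := -(T / u)) (b := T / u)
      (fun x : ℝ => exp (-(2 * (Real.pi : ℂ) * I * ((1 : ℝ) : ℂ) * (x : ℂ))) *
        ((u / (x ^ 2 + u ^ 2) : ℝ) : ℂ) ^ (ν + 1 / 2) *
        (((x : ℂ) - I * (u : ℂ)) / ((x : ℂ) + I * (u : ℂ))) ^ p) hu.ne'
    rw [mul_neg, mul_div_cancel₀ T hu.ne', eq_inv_smul_iff₀ hu.ne'] at hsub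
    rw [← hsub, real_smul, mul_assoc, mul_assoc, Function.comp_apply, ← mul_assoc (_ ^ _),
      ← intervalIntegral.integral_const_mul]
    congr 1
    refine intervalIntegral.integral_congr fun t _ => ?_
    simp only [mul_assoc (exp _)]
    rw [principalSeries_integrand_eq _ p hu]
    push_cast
    ring_nf
  have hAphi : Aphi ν p 1 u = u * (u : ℂ) ^ (-(ν + 1 / 2)) * (-1) ^ p * L := hA.limUnder_eq
  rw [hAphi, map_mul, map_mul, map_mul, hconj_u, conj_ofReal, map_zpow₀, map_neg, map_one]
  refine Tendsto.const_mul _ (((continuous_conj.tendsto _).comp hL).congr fun R => ?_)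
  have conj_integral (f : ℝ → ℂ) :
      starRingEnd ℂ (∫ t in (-R)..R, f t) = ∫ t in (-R)..R, starRingEnd ℂ (f t) := by
    simp only [intervalIntegral, map_sub, ← integral_conj]
  rw [Function.comp_apply, conj_integral]
  conv_rhs => rw [← neg_neg R, ← intervalIntegral.integral_comp_neg, neg_neg]
  refine intervalIntegral.integral_congr fun t _ => ?_
  simp only [map_mul, conj_cauchyKernel, ← exp_conj, map_sub _ (ν + 1 / 2),
    map_add _ (ν + 1 / 2), hconj, map_intCast]
  simp [show starRingEnd ℂ 2 = 2 from map_ofNat _ 2]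

lemma integral_integral_cpow_mul_cauchyKernel {A : ℂ} (hA : 0 < A.re) {r : ℝ} (hr : 0 < r)
    (a b : ℂ) (R : ℝ) :
    ∫ u : ℝ in Ioi 0, ∫ t in (-R)..R,
        (u : ℂ) ^ (A - 1) * exp (-(r * (1 + t * I) * u)) * cauchyKernel a b t =
      (1 / r) ^ A * Gamma A * ∫ t in (-R)..R, cauchyKernel (A + a) b t := by
  rw [← intervalIntegral_integral_swap, ← intervalIntegral.integral_const_mul]
  · refine intervalIntegral.integral_congr fun t _ => ?_
    rw [integral_mul_const, integral_cpow_mul_exp_neg_one_add_mul_I hA hr, cauchyKernel,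
      cauchyKernel, neg_add, cpow_add _ _ (slitPlane_ne_zero (one_add_mul_I_mem_slitPlane t))]
    ring
  · have hK : Integrable (fun t => ‖cauchyKernel a b t‖) (volume.restrict (uIoc (-R) R)) :=
      ((continuous_cauchyKernel a b).norm.intervalIntegrable (-R) R).def'
    have hG := integrableOn_rpow_mul_exp_neg hA hr
    refine Integrable.mono' (hK.mul_prod hG) ?_ ?_
    · have := (continuous_cauchyKernel a b).measurable
      refine Measurable.aestronglyMeasurable ?_
      unfold Function.uncurry
      fun_prop
    · rw [Measure.prod_restrict]
      filter_upwards [ae_restrict_mem (measurableSet_uIoc.prod measurableSet_Ioi)] with z hz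
      rw [Function.uncurry, norm_mul, norm_cpow_mul_exp_neg A r z.1 hz.2, mul_comm]

end

/-- For purely imaginary `ν`, `p ∈ ℤ` and `Re α > 1`,
`(1/π) ∫₀^∞ u^{α-1} e^{-2πu} conj(A⁺φ_p(u;ν)) du
  = (-1)^p 2^{-2α} π^{-ν-α-1/2} Γ(α+ν+1/2)Γ(α-ν+1/2) / (Γ(1/2-ν+p)Γ(α+1-p))`. -/
theorem statement5 (ν : ℂ) (hν : ν.re = 0) (p : ℤ) (α : ℂ) (hα : 1 < α.re) :
    (1 / (Real.pi : ℂ)) *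
        ∫ u : ℝ in Set.Ioi (0 : ℝ),
          ((u : ℂ) ^ (α - 1)) * Complex.exp (-(2 * (Real.pi : ℂ) * (u : ℂ))) *
            (starRingEnd ℂ) (Aphi ν p 1 u)
      = (-1 : ℂ) ^ p * (2 : ℂ) ^ (-(2 * α)) * ((Real.pi : ℂ)) ^ (-ν - α - 1 / 2) *
          (Complex.Gamma (α + ν + 1 / 2) * Complex.Gamma (α - ν + 1 / 2)) /
          (Complex.Gamma (1 / 2 - ν + (p : ℂ)) * Complex.Gamma (α + 1 - (p : ℂ))) := by
  have hu_int : ∀ R u : ℝ, 0 < u →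
      (u : ℂ) ^ (α - 1) * Complex.exp (-(2 * (Real.pi : ℂ) * u)) *
        (u * (u : ℂ) ^ (-(1 / 2 - ν)) * (-1) ^ p * ∫ t in (-R)..R,
          Complex.exp (-(2 * (Real.pi : ℂ) * Complex.I * u * t)) *
            cauchyKernel (1 / 2 - ν - p) (1 / 2 - ν + p) t) =
      (-1) ^ p * ((u : ℂ) ^ (α + ν + 1 / 2 - 1) *
        Complex.exp (-((2 * Real.pi : ℝ) * (1 + (0 : ℝ) * Complex.I) * u))) *
        ∫ t in (-R)..R, Complex.exp (-(2 * (Real.pi : ℂ) * Complex.I * u * t)) *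
            cauchyKernel (1 / 2 - ν - p) (1 / 2 - ν + p) t := by
    intro R u hu
    have hu0 : (u : ℂ) ≠ 0 := Complex.ofReal_ne_zero.2 hu.ne'
    have : (u : ℂ) ^ (α + ν + 1 / 2 - 1) = (u : ℂ) ^ (α - 1) * u * (u : ℂ) ^ (-(1 / 2 - ν)) := by
      rw [← cpow_add_one_of_ne_zero hu0, ← Complex.cpow_add _ _ hu0]
      congr 1
      ring
    rw [this]
    push_cast
    ring_nf
  have hA : 0 < (α + ν + 1 / 2).re := by simp [hν]; linarith
  obtain ⟨C, hC⟩ := tendsto_and_norm_integral_exp_mul_cauchyKernel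
    (a := 1 / 2 - ν - p) (b := 1 / 2 - ν + p) (by simp [hν])
  have hlim : Tendsto (fun R : ℝ => ∫ u : ℝ in Set.Ioi 0,
      (u : ℂ) ^ (α - 1) * Complex.exp (-(2 * (Real.pi : ℂ) * u)) *
        (u * (u : ℂ) ^ (-(1 / 2 - ν)) * (-1) ^ p * ∫ t in (-R)..R,
          Complex.exp (-(2 * (Real.pi : ℂ) * Complex.I * u * t)) *
            cauchyKernel (1 / 2 - ν - p) (1 / 2 - ν + p) t)) atTop
      (nhds (∫ u : ℝ in Set.Ioi 0, (u : ℂ) ^ (α - 1) *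
        Complex.exp (-(2 * (Real.pi : ℂ) * u)) * starRingEnd ℂ (Aphi ν p 1 u))) := by
    refine tendsto_integral_filter_of_dominated_convergence
      (fun u => C * (u ^ (α.re - 1 / 2 - 1) * Real.exp (-(2 * Real.pi) * u)))
      (Eventually.of_forall fun R => ?_) (Eventually.of_forall fun R => ?_)
      ((integrableOn_rpow_mul_exp_neg (by linarith) Real.two_pi_pos).const_mul C) ?_
    · have hG : Continuous fun u : ℝ => ∫ t in (-R)..R,
          Complex.exp (-(2 * (Real.pi : ℂ) * Complex.I * u * t)) *
            cauchyKernel (1 / 2 - ν - p) (1 / 2 - ν + p) t := by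
        refine intervalIntegral.continuous_parametric_intervalIntegral_of_continuous' ?_ _ _
        have := continuous_cauchyKernel (1 / 2 - ν - p) (1 / 2 - ν + p)
        unfold Function.uncurry
        fun_prop
      have := hG.measurable
      exact Measurable.aestronglyMeasurable (by fun_prop)
    · filter_upwards [ae_restrict_mem measurableSet_Ioi] with u hu
      have hu : 0 < u := hu
      rw [hu_int R u hu, norm_mul, norm_mul, norm_cpow_mul_exp_neg _ _ _ hu]
      calc _ = u ^ ((α + ν + 1 / 2).re - 1) * Real.exp (-(2 * Real.pi) * u) * _ := by
            rw [norm_zpow, norm_neg, norm_one, one_zpow, one_mul]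
        _ ≤ u ^ ((α + ν + 1 / 2).re - 1) * Real.exp (-(2 * Real.pi) * u) * (C * u⁻¹) := by
            gcongr
            exact (hC u hu).2 R
        _ = _ := by
            have : u ^ (α.re - 1 / 2 - 1) = u ^ ((α + ν + 1 / 2).re - 1) * u⁻¹ := by
              rw [← Real.rpow_neg_one, ← Real.rpow_add hu]
              congr 1
              simp [hν]
              ring
            rw [this]
            ring
    · filter_upwards [ae_restrict_mem measurableSet_Ioi] with u hu
      exact (tendsto_conj_Aphi hν p hu).const_mul _
  have hfub : ∀ R : ℝ, ∫ u : ℝ in Set.Ioi 0,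
      (u : ℂ) ^ (α - 1) * Complex.exp (-(2 * (Real.pi : ℂ) * u)) *
        (u * (u : ℂ) ^ (-(1 / 2 - ν)) * (-1) ^ p * ∫ t in (-R)..R,
          Complex.exp (-(2 * (Real.pi : ℂ) * Complex.I * u * t)) *
            cauchyKernel (1 / 2 - ν - p) (1 / 2 - ν + p) t) =
      (-1) ^ p * ((1 / (2 * Real.pi : ℝ)) ^ (α + ν + 1 / 2) * Complex.Gamma (α + ν + 1 / 2) *
        ∫ t in (-R)..R, cauchyKernel (α + ν + 1 / 2 + (1 / 2 - ν - p)) (1 / 2 - ν + p) t) := by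
    intro R
    rw [← integral_integral_cpow_mul_cauchyKernel hA Real.two_pi_pos, ← integral_const_mul]
    refine setIntegral_congr_fun measurableSet_Ioi fun u hu => ?_
    refine (hu_int R u hu).trans ?_
    rw [mul_assoc, ← intervalIntegral.integral_const_mul]
    congr 1
    refine intervalIntegral.integral_congr fun t _ => ?_
    simp only [← mul_assoc]
    rw [mul_assoc (_ ^ _), ← Complex.exp_add]
    congr 3
    push_cast
    ring
  simp_rw [hfub] at hlim
  have hkernel : 1 < (α + ν + 1 / 2 + (1 / 2 - ν - p) + (1 / 2 - ν + p)).re := by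
    simp [hν]; linarith
  have heq := tendsto_nhds_unique hlim (((intervalIntegral_tendsto_integral
    (integrable_cauchyKernel hkernel) tendsto_neg_atTop_atBot tendsto_id).const_mul
      _).const_mul _)
  have hbeta := integral_cauchyKernel_shift (a := α) (b := 3 / 2 - ν) hα
    (by simp [hν]; norm_num) (fun n h => by
      have h := congrArg Complex.re h
      simp [hν] at h
      have : ((3 + 2 * n : ℤ) : ℝ) = 0 := by push_cast; linarith
      have : 3 + 2 * n = 0 := by exact_mod_cast this
      omega) (p - 1)
  have e1 : α + ν + 1 / 2 + (1 / 2 - ν - p) = α - ((p - 1 : ℤ) : ℂ) := by push_cast; ring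
  have e2 : 1 / 2 - ν + p = 3 / 2 - ν + ((p - 1 : ℤ) : ℂ) := by push_cast; ring
  have e3 : α + 1 - p = α - ((p - 1 : ℤ) : ℂ) := by push_cast; ring
  have e4 : α + (3 / 2 - ν) - 1 = α - ν + 1 / 2 := by ring
  rw [heq, e1, e2, e3, hbeta, e4]
  have h2 : ∀ z : ℂ, (1 / 2 : ℂ) ^ z = 2 ^ (-z) := fun z => by
    rw [one_div, Complex.inv_cpow _ _ (by simpa using Real.pi_ne_zero.symm), Complex.cpow_neg]
  have hpi : (1 / ((2 * Real.pi : ℝ) : ℂ)) ^ (α + ν + 1 / 2) =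
      2 ^ (-(α + ν + 1 / 2)) * (Real.pi : ℂ) ^ (-ν - α - 1 / 2) := by
    have hmul := Complex.mul_cpow_ofReal_nonneg (a := 2) (b := Real.pi) zero_le_two
      Real.pi_pos.le (-(α + ν + 1 / 2))
    rw [one_div, Complex.inv_cpow _ _ (by
      rw [Complex.arg_ofReal_of_nonneg Real.two_pi_pos.le]; exact Real.pi_ne_zero.symm),
      ← Complex.cpow_neg, Complex.ofReal_mul, hmul]
    congr 2
    ring
  have h2pow : (2 : ℂ) ^ (-(2 * α)) =
      2 * (2 ^ (-(α + ν + 1 / 2)) * 2 ^ (-(α - ν + 1 / 2))) := by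
    rw [← Complex.cpow_add _ _ two_ne_zero, mul_comm 2 (_ ^ _), ← cpow_add_one_of_ne_zero two_ne_zero]
    congr 1
    ring
  have hpi0 : (Real.pi : ℂ) ≠ 0 := Complex.ofReal_ne_zero.2 Real.pi_ne_zero
  rw [h2, hpi, h2pow, mul_comm (Complex.Gamma (3 / 2 - ν + _))]
  simp only [div_eq_mul_inv]
  field_simp
end
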